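/- For every splay access (to element s, with search path P containing z side alternations, producing after-tree A): A has at least ⌊|P|/2⌋ − 1 − z leaves, every element of P larger than s has right-depth at most 2 in A, and every element of P smaller than s has left-depth at most 2 in A. -/

import Mathlib

namespace Paper

inductive BTree where
  | nil : BTree
  | node : BTree → ℕ → BTree → BTree
deriving DecidableEq

namespace BTree

def keys : BTree → Finset ℕ
  | nil => ∅
  | node l x r => insert x (keys l ∪ keys r)

def root? : BTree → Option ℕ
  | nil => none
  | node _ x _ => some x

def isBST : BTree → Prop
  | nil => True
  | node l x r => (∀ y ∈ keys l, y < x) ∧ (∀ y ∈ keys r, x < y) ∧ isBST l ∧ isBST r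

def subtree? (s : ℕ) : BTree → Option BTree
  | nil => none
  | node l x r => if s = x then some (node l x r) else if s < x then subtree? s l else subtree? s r

/-- The set of keys of the subtree rooted at `s` (∅ if `s` is not in the tree). -/
def subtreeKeys (T : BTree) (s : ℕ) : Finset ℕ := ((subtree? s T).map keys).getD ∅

/-- The search path to `s`, listed from the root downwards. -/
def pathList (s : ℕ) : BTree → List ℕ
  | nil => []
  | node l x r => if s = x then [x] else if s < x then x :: pathList s l else x :: pathList s r

def pathSet (T : BTree) (s : ℕ) : Finset ℕ := (pathList s T).toFinset

def nodeDepth (s : ℕ) : BTree → ℕ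
  | nil => 0
  | node l x r => if s = x then 0 else if s < x then nodeDepth s l + 1 else nodeDepth s r + 1

/-- Number of right-going edges on the path from the root to `s`. -/
def rightDepth (s : ℕ) : BTree → ℕ
  | nil => 0
  | node l x r => if s = x then 0 else if s < x then rightDepth s l else rightDepth s r + 1

/-- Number of left-going edges on the path from the root to `s`. -/
def leftDepth (s : ℕ) : BTree → ℕ
  | nil => 0
  | node l x r => if s = x then 0 else if s < x then leftDepth s l + 1 else leftDepth s r

def leafCount : BTree → ℕ
  | nil => 0
  | node nil _ nil => 1
  | node l _ r => leafCount l + leafCount r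

/-- The wing partition of a BST, each wing listed from its topmost node downwards. -/
def wings : BTree → List (List ℕ)
  | nil => []
  | node l x r =>
    match wings l with
    | [] => [x] :: wings r
    | wl :: rest => (x :: wl) :: (rest ++ wings r)

end BTree

open BTree

/-- The left-leaning path on `[n]`: `n` at the root, `1` at the deepest node. -/
def leftPathTree : ℕ → BTree
  | 0 => BTree.nil
  | n + 1 => BTree.node (leftPathTree n) (n + 1) BTree.nil

/-- Number of side alternations (w.r.t. `s`) between adjacent elements of a list. -/
def sideAlt (s : ℕ) : List ℕ → ℕ
  | x :: y :: rest => (if (x < s ∧ s < y) ∨ (y < s ∧ s < x) then 1 else 0) + sideAlt s (y :: rest)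
  | _ => 0

/-- The set of elements involved in side alternations (w.r.t. `s`) in a list. -/
def zigzagSet (s : ℕ) : List ℕ → Finset ℕ
  | x :: y :: rest =>
    (if (x < s ∧ s < y) ∨ (y < s ∧ s < x) then ({x, y} : Finset ℕ) else ∅) ∪ zigzagSet s (y :: rest)
  | _ => ∅

noncomputable def wsum (w : ℕ → ℝ) (X : Finset ℕ) : ℝ := ∑ b ∈ X, w b

/-- Partial sum-of-logs potential of the set `X` in tree `T` (binary logarithm). -/
noncomputable def phiOn (w : ℕ → ℝ) (T : BTree) (X : Finset ℕ) : ℝ :=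
  ∑ a ∈ X, Real.logb 2 (wsum w (subtreeKeys T a))

noncomputable def phiAll (w : ℕ → ℝ) (T : BTree) : ℝ := phiOn w T (keys T)

/-- A single access of a minimally self-adjusting BST algorithm: the accessed element `s`
becomes the root, the keys are unchanged, and every node off the search path keeps its
subtree; hence the search path is replaced by an after-tree rooted at `s` and the pendent
subtrees are reattached in the unique order-preserving way. -/
structure IsAccess (T : BTree) (s : ℕ) (T' : BTree) : Prop where
  hT : isBST T
  hT' : isBST T'
  hs : s ∈ keys T
  hkeys : keys T' = keys T
  hroot : root? T' = some s
  hpendent : ∀ a ∈ keys T, a ∉ pathSet T s → subtree? a T' = subtree? a T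

/-- The algorithm (viewed as the set of accesses it may perform) satisfies the access lemma
via the sum-of-logs potential. -/
def SatisfiesAL (Alg : BTree → ℕ → BTree → Prop) : Prop :=
  ∃ C : ℝ, 0 ≤ C ∧ ∀ T s T', Alg T s T' → ∀ w : ℕ → ℝ, (∀ i ∈ keys T, 0 < w i) →
    ((pathSet T s).card : ℝ) ≤
      phiAll w T - phiAll w T' + C * (1 + Real.logb 2 (wsum w (keys T) / w s))

/-- `X` is subtree-disjoint (w.r.t. the tree after the access). -/
def SubtreeDisjoint (T' : BTree) (X : Finset ℕ) : Prop :=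
  ∀ a ∈ X, ∀ b ∈ X, a ≠ b → subtreeKeys T' a ∩ subtreeKeys T' b = ∅

/-- `X` is monotone: all elements on one side of `s`, with equal right-depth
(resp. left-depth) in the after-tree.  (For nodes of the search path, depth in the
after-tree coincides with depth in `T'`.) -/
def IsMonotone (s : ℕ) (T' : BTree) (X : Finset ℕ) : Prop :=
  ((∀ x ∈ X, s < x) ∧ ∃ d, ∀ x ∈ X, rightDepth x T' = d) ∨
  ((∀ x ∈ X, x < s) ∧ ∃ d, ∀ x ∈ X, leftDepth x T' = d)

/-- The after-tree minus its root can be partitioned into (at most) `k` monotone sets. -/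
def MonotoneDecomp (T : BTree) (s : ℕ) (T' : BTree) (k : ℕ) : Prop :=
  ∃ M : Fin k → Finset ℕ,
    (∀ i, IsMonotone s T' (M i)) ∧
    (∀ i j, i ≠ j → Disjoint (M i) (M j)) ∧
    Finset.univ.biUnion M = pathSet T s \ {s}

/-- The leaves of the after-tree: path nodes having no path node as proper descendant in `T'`. -/
def afterLeaves (T : BTree) (s : ℕ) (T' : BTree) : Finset ℕ :=
  (pathSet T s).filter (fun x => subtreeKeys T' x ∩ pathSet T s = {x})

/-- Rotate-to-root: `s` becomes the root and ancestor relations are otherwise preserved,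
equivalently `T'(a) = T(a) ∩ (-∞,s)` for path nodes `a < s` and symmetrically for `a > s`. -/
def IsRotateToRoot (T : BTree) (s : ℕ) (T' : BTree) : Prop :=
  subtreeKeys T' s = keys T ∧
  ∀ a ∈ pathSet T s,
    (a < s → subtreeKeys T' a = (subtreeKeys T a).filter (fun b => b < s)) ∧
    (s < a → subtreeKeys T' a = (subtreeKeys T a).filter (fun b => s < b))

def pendTree : Option ℕ → BTree
  | none => BTree.nil
  | some u => BTree.node BTree.nil u BTree.nil

def buildLeft (l : List (ℕ × Option ℕ)) : BTree :=
  l.foldl (fun t vc => BTree.node (pendTree vc.2) vc.1 t) BTree.nil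

def buildRight (l : List (ℕ × Option ℕ)) : BTree :=
  l.foldl (fun t vc => BTree.node t vc.1 (pendTree vc.2)) BTree.nil

/-- Global view of splay: process the reversed search path `v₁, v₂, …` in pairs; if a pair
lies on the same side of `s`, the more ancestral element is removed from its path and
becomes a (pendant) child of the other.  Returns the two spines (elements `< s` and `> s`),
deepest first, each spine node with its optional pendant child. -/
def splaySpines (s : ℕ) : List ℕ → List (ℕ × Option ℕ) × List (ℕ × Option ℕ)
  | [] => ([], [])
  | [v] => if v < s then ([(v, none)], []) else ([], [(v, none)])
  | v :: u :: rest =>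
    let p := splaySpines s rest
    if v < s then
      if u < s then ((v, some u) :: p.1, p.2)
      else ((v, none) :: p.1, (u, none) :: p.2)
    else
      if u < s then ((u, none) :: p.1, (v, none) :: p.2)
      else (p.1, (v, some u) :: p.2)

/-- The after-tree of a splay access, built from the reversed search path without `s`. -/
def splayAfterTree (s : ℕ) (l : List ℕ) : BTree :=
  BTree.node (buildLeft (splaySpines s l).1) s (buildRight (splaySpines s l).2)

/-- A splay access: a valid access whose after-tree (the restriction of `T'` to the search
path) is the splay after-tree. -/
def IsSplayAccess (T : BTree) (s : ℕ) (T' : BTree) : Prop :=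
  IsAccess T s T' ∧
  ∀ x ∈ pathSet T s,
    subtreeKeys T' x ∩ pathSet T s = subtreeKeys (splayAfterTree s (pathList s T).reverse.tail) x

/-- A path-balance access: a valid access whose after-tree is a balanced BST of depth
`⌈log₂ (1 + |P|)⌉` rooted at `s`. -/
def IsPathBalanceAccess (T : BTree) (s : ℕ) (T' : BTree) : Prop :=
  IsAccess T s T' ∧
  ∀ x ∈ pathSet T s, nodeDepth x T' ≤ Nat.clog 2 (1 + (pathSet T s).card)

def isParent (Q : BTree) (x y : ℕ) : Prop := pathList y Q = pathList x Q ++ [y]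

/-- One step of a decomposition: a (descending) path `Pi` of `Q` is rearranged into a tree,
all other nodes keeping their subtrees. -/
def StepRel (Q Q' : BTree) (Pi : Finset ℕ) : Prop :=
  isBST Q' ∧ keys Q' = keys Q ∧
  (∃ l : List ℕ, l ≠ [] ∧ List.Chain' (isParent Q) l ∧ l.toFinset = Pi) ∧
  (∀ a ∈ keys Q, a ∉ Pi → subtree? a Q' = subtree? a Q)

/-- The transformation of the before-path `P0` (as a tree) into the after-tree `A` admits a
local decomposition with window size `wdw`. -/
def HasLocalDecomp (s : ℕ) (P0 A : BTree) (wdw : ℕ) : Prop :=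
  ∃ (k : ℕ) (Q : ℕ → BTree) (Ps : ℕ → Finset ℕ),
    1 ≤ k ∧ Q 0 = P0 ∧ Q k = A ∧
    (∀ i < k, StepRel (Q i) (Q (i + 1)) (Ps i)) ∧
    s ∈ Ps 0 ∧
    (∀ i, i + 1 < k → (Ps (i + 1) \ Ps i).Nonempty) ∧
    (∀ i, i + 1 < k → (Ps (i + 1) ∩ Ps i).Nonempty) ∧
    (∀ i j, i + 1 < j → j < k → Disjoint (Ps i \ Ps (i + 1)) (Ps j)) ∧
    (∀ i < k, (Ps i).card ≤ wdw)

/-- The search path to `s` in `T`, as a tree (the before-path of the transformation). -/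
def pathTree (s : ℕ) : BTree → BTree
  | BTree.nil => BTree.nil
  | BTree.node l x r =>
    if s = x then BTree.node BTree.nil x BTree.nil
    else if s < x then BTree.node (pathTree s l) x BTree.nil
    else BTree.node BTree.nil x (pathTree s r)

/-- `A` is the after-tree of the access `(T, s, T')`: the restriction of `T'` to the search path. -/
def IsAfterTree (T : BTree) (s : ℕ) (T' A : BTree) : Prop :=
  isBST A ∧ keys A = pathSet T s ∧
  ∀ x ∈ pathSet T s, subtreeKeys A x = subtreeKeys T' x ∩ pathSet T s

/-- The algorithm is local with window size `wdw`. -/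
def IsLocal (Alg : BTree → ℕ → BTree → Prop) (wdw : ℕ) : Prop :=
  ∀ T s T', Alg T s T' → ∀ A, IsAfterTree T s T' A → HasLocalDecomp s (pathTree s T) A wdw

open scoped Classical in
noncomputable def stair (n : ℕ) (h : ℕ → ℕ) (s : ℕ) : Finset ℕ :=
  (Finset.Icc 1 n).filter
    (fun b => ∀ b' ∈ Finset.Icc 1 n, ((s < b' ∧ b' < b) ∨ (b < b' ∧ b' < s)) → h b' < h b)

open scoped Classical in
noncomputable def nbhd (n : ℕ) (h : ℕ → ℕ) (a : ℕ) : Finset ℕ :=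
  (Finset.Icc 1 n).filter
    (fun b => ∀ b' ∈ Finset.Icc 1 n, b' ≠ a → min a b ≤ b' → b' ≤ max a b → h b' < h a)

/-- Geometric sum-of-logs partial potential. -/
noncomputable def phiGeo (n : ℕ) (h : ℕ → ℕ) (w : ℕ → ℝ) (X : Finset ℕ) : ℝ :=
  ∑ a ∈ X, Real.logb 2 (wsum w (nbhd n h a))

/-- `l` is (the reversal of) a valid search path to `s`, without `s`, deepest element first. -/
def ValidRevPath (s : ℕ) (l : List ℕ) : Prop :=
  l.Nodup ∧ s ∉ l ∧
  l.Pairwise (fun a b => (a < s → b < s → b < a) ∧ (s < a → s < b → a < b))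

end Paper

open Paper Paper.BTree

namespace Paper

/-- The nodes of a spine with pendants, deepest first, each pendant after its spine node. -/
def spineKeys (l : List (ℕ × Option ℕ)) : List ℕ :=
  l.flatMap fun vc => vc.1 :: vc.2.toList

/-- The number of pendants attached to a spine. -/
def pendantCount (l : List (ℕ × Option ℕ)) : ℕ := l.countP fun vc => vc.2.isSome

theorem spineKeys_splaySpines (s : ℕ) (l : List ℕ) :
    spineKeys (splaySpines s l).1 = l.filter (· < s) ∧
      spineKeys (splaySpines s l).2 = l.filter (¬ · < s) := by
  induction l using splaySpines.induct s <;>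
    grind [splaySpines, spineKeys]

theorem length_div_two_le_pendantCount_add_sideAlt (s : ℕ) (l : List ℕ) (hs : s ∉ l) :
    l.length / 2 ≤
      pendantCount (splaySpines s l).1 + pendantCount (splaySpines s l).2 + sideAlt s l := by
  have tail_le : ∀ (x : ℕ) (l : List ℕ), sideAlt s l ≤ sideAlt s (x :: l) := by
    rintro x (_ | ⟨y, l⟩) <;> simp [sideAlt]
  induction l using splaySpines.induct s with
  | case1 => simp
  | case2 => simp
  | case3 => simp
  | case4 v u rest hv hu ih | case5 v u rest hv hu ih
  | case6 v u rest hv hu ih | case7 v u rest hv hu ih =>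
    simp only [List.mem_cons, not_or] at hs
    have hrest := ih hs.2.2
    have := tail_le u rest
    rw [pendantCount, pendantCount] at hrest
    simp only [splaySpines, hv, hu, if_true, if_false, sideAlt, pendantCount, List.countP_cons,
      Option.isSome_some, Option.isSome_none, Bool.false_eq_true, List.length_cons]
    grind

theorem leafCount_add_le (a b : BTree) (x : ℕ) :
    leafCount a + leafCount b ≤ leafCount (BTree.node a x b) := by
  cases a <;> cases b <;> simp [leafCount]

theorem leafCount_pendTree (c : Option ℕ) : leafCount (pendTree c) = if c.isSome then 1 else 0 := by
  cases c <;> simp [pendTree, leafCount]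

theorem buildLeft_append_singleton (l : List (ℕ × Option ℕ)) (p : ℕ × Option ℕ) :
    buildLeft (l ++ [p]) = BTree.node (pendTree p.2) p.1 (buildLeft l) := by
  simp [buildLeft]

theorem buildRight_append_singleton (l : List (ℕ × Option ℕ)) (p : ℕ × Option ℕ) :
    buildRight (l ++ [p]) = BTree.node (buildRight l) p.1 (pendTree p.2) := by
  simp [buildRight]

theorem pendantCount_append_singleton (l : List (ℕ × Option ℕ)) (p : ℕ × Option ℕ) :
    pendantCount (l ++ [p]) = pendantCount l + leafCount (pendTree p.2) := by
  simp [pendantCount, leafCount_pendTree, List.countP_singleton]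

theorem spineKeys_append_singleton (l : List (ℕ × Option ℕ)) (p : ℕ × Option ℕ) :
    spineKeys (l ++ [p]) = spineKeys l ++ p.1 :: p.2.toList := by
  simp [spineKeys]

theorem pendantCount_le_leafCount_buildLeft (l : List (ℕ × Option ℕ)) :
    pendantCount l ≤ leafCount (buildLeft l) := by
  induction l using List.reverseRecOn with
  | nil => simp [pendantCount]
  | append_singleton l p ih =>
    rw [buildLeft_append_singleton, pendantCount_append_singleton]
    have := leafCount_add_le (pendTree p.2) (buildLeft l) p.1
    omega

theorem pendantCount_le_leafCount_buildRight (l : List (ℕ × Option ℕ)) :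
    pendantCount l ≤ leafCount (buildRight l) := by
  induction l using List.reverseRecOn with
  | nil => simp [pendantCount]
  | append_singleton l p ih =>
    rw [buildRight_append_singleton, pendantCount_append_singleton]
    have := leafCount_add_le (buildRight l) (pendTree p.2) p.1
    omega

theorem leftDepth_buildLeft_le_one (l : List (ℕ × Option ℕ))
    (hl : (spineKeys l).Pairwise (fun a b => b < a)) {x : ℕ} (hx : x ∈ spineKeys l) :
    leftDepth x (buildLeft l) ≤ 1 := by
  induction l using List.reverseRecOn with
  | nil => simp [buildLeft, leftDepth]
  | append_singleton l p ih =>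
    obtain ⟨v, c⟩ := p
    rw [spineKeys_append_singleton] at hl hx
    rw [buildLeft_append_singleton]
    cases c <;> grind [leftDepth, pendTree]

theorem rightDepth_buildRight_le_one (l : List (ℕ × Option ℕ))
    (hl : (spineKeys l).Pairwise (fun a b => a < b)) {x : ℕ} (hx : x ∈ spineKeys l) :
    rightDepth x (buildRight l) ≤ 1 := by
  induction l using List.reverseRecOn with
  | nil => simp [buildRight, rightDepth]
  | append_singleton l p ih =>
    obtain ⟨v, c⟩ := p
    rw [spineKeys_append_singleton] at hl hx
    rw [buildRight_append_singleton]
    cases c <;> grind [rightDepth, pendTree]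

end Paper

/-- **Splay access combinatorics.** For every splay access (before-path given by the valid
reversed search path `l` without `s`, after-tree `A = splayAfterTree s l`): `A` has at
least `⌊|P|/2⌋ − 1 − z` leaves, and every path element larger (smaller) than `s` has
right-depth (left-depth) at most `2` in `A`. -/
theorem splay_after_tree_properties (s : ℕ) (l : List ℕ) (hl : ValidRevPath s l) :
    (((l.length + 1) / 2 : ℕ) : ℤ) - 1 - (sideAlt s l : ℤ) ≤
        (leafCount (splayAfterTree s l) : ℤ) ∧
    (∀ x ∈ l, s < x → rightDepth x (splayAfterTree s l) ≤ 2) ∧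
    (∀ x ∈ l, x < s → leftDepth x (splayAfterTree s l) ≤ 2) := by
  obtain ⟨-, hs, hord⟩ := hl
  obtain ⟨hL, hR⟩ := spineKeys_splaySpines s l
  refine ⟨?_, fun x hx hsx => ?_, fun x hx hxs => ?_⟩
  · have hcount := length_div_two_le_pendantCount_add_sideAlt s l hs
    have hleft := pendantCount_le_leafCount_buildLeft (splaySpines s l).1
    have hright := pendantCount_le_leafCount_buildRight (splaySpines s l).2
    have hroot := leafCount_add_le (buildLeft (splaySpines s l).1)
      (buildRight (splaySpines s l).2) s
    rw [splayAfterTree]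
    omega
  · have hdepth : rightDepth x (buildRight (splaySpines s l).2) ≤ 1 := by
      apply rightDepth_buildRight_le_one
      · rw [hR, List.pairwise_filter]
        exact hord.imp_of_mem fun ha hb h ha' hb' => by grind
      · rw [hR]
        simp [hx, hsx.le]
    simpa [splayAfterTree, rightDepth, hsx.ne', hsx.not_gt] using hdepth
  · have hdepth : leftDepth x (buildLeft (splaySpines s l).1) ≤ 1 := by
      apply leftDepth_buildLeft_le_one
      · rw [hL, List.pairwise_filter]
        exact hord.imp fun h ha hb => by grind
      · rw [hL]
        simp [hx, hxs]
    simpa [splayAfterTree, leftDepth, hxs.ne, hxs] using hdepth
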